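/- Let δ ∈ (0, 1/2) and let R : {x ∈ ℝ³ : |x| > 1} → ℝ be C¹ with constants c > 0 such that |R(x)| ≤ c|x|⁻⁴, |∇R(x)| ≤ c|x|⁻⁵, ∑_{i=1}^{3} xⁱ ∂ᵢ(|x|² R(x)) ≤ c|x|⁻³, and |R(x) − R(−x)| ≤ c|x|⁻⁵ for all |x| > 1. For λ > 2/δ and |ξ| < 1 − δ set G_{2,λ}(ξ) = 2λ ∫_{{x : |x − λξ| ≥ λ}} R(x) dx. Then there exist C > 0 and λ₀ > 0 such that for all λ ≥ λ₀ and all ξ with 0 < |ξ| < 1 − δ one has |ξ|⁻¹ ⟨∇_ξ G_{2,λ}(ξ), ξ⟩ ≥ −C λ⁻¹. -/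

import Mathlib

open MeasureTheory Metric

noncomputable abbrev E3 := EuclideanSpace ℝ (Fin 3)

/-- `G2 R lam ξ = 2 λ ∫_{{x : |x − λξ| ≥ λ}} R(x) dx`. -/
noncomputable def G2 (R : E3 → ℝ) (lam : ℝ) (ξ : E3) : ℝ :=
  2 * lam * ∫ x in {x : E3 | lam ≤ ‖x - lam • ξ‖}, R x

noncomputable abbrev S2 := sphere (0 : E3) 1

noncomputable def sig : Measure S2 := (volume : Measure E3).toSphere

instance : IsFiniteMeasure sig := by unfold sig; infer_instance

lemma polar (F : E3 → ℝ) (hF : Integrable F) :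
    Integrable (fun θ : S2 => ∫ r in Set.Ioi (0:ℝ), r ^ 2 * F (r • (θ : E3))) sig ∧
    ∫ x, F x = ∫ θ : S2, (∫ r in Set.Ioi (0:ℝ), r ^ 2 * F (r • (θ : E3))) ∂sig := by
  have hmp := (volume : Measure E3).measurePreserving_homeomorphUnitSphereProd
  have hd : Module.finrank ℝ E3 - 1 = 2 := by simp
  rw [hd] at hmp
  let H : S2 × Set.Ioi (0:ℝ) → ℝ := fun p => F (p.2.1 • (p.1 : E3))
  have hH : ∀ x : ({(0 : E3)}ᶜ : Set E3), H (homeomorphUnitSphereProd E3 x) = F x := by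
    intro x
    have h := congrArg Subtype.val ((homeomorphUnitSphereProd E3).symm_apply_apply x)
    rw [homeomorphUnitSphereProd_symm_apply_coe] at h
    simp only [H]
    rw [h]
  have hint : Integrable H (sig.prod (Measure.volumeIoiPow 2)) := by
    have := hmp.integrable_comp_emb (g := H) (Homeomorph.measurableEmbedding _)
    rw [sig, ← this]
    have h2 : H ∘ (homeomorphUnitSphereProd E3) = F ∘ Subtype.val := by
      funext x; exact hH x
    rw [h2, ← integrableOn_iff_comap_subtypeVal (measurableSet_singleton _).compl]
    exact hF.integrableOn
  have hin : ∀ θ : S2, ∫ r : Set.Ioi (0:ℝ), H (θ, r) ∂(Measure.volumeIoiPow 2) =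
      ∫ r in Set.Ioi (0:ℝ), r ^ 2 * F (r • (θ : E3)) := by
    intro θ
    simp only [Measure.volumeIoiPow, ENNReal.ofReal]
    rw [integral_withDensity_eq_integral_smul]
    · simp only [H]
      rw [integral_subtype_comap measurableSet_Ioi
        (fun a : ℝ ↦ Real.toNNReal (a ^ 2) • F (a • (θ : E3))),
        setIntegral_congr_fun measurableSet_Ioi fun x hx ↦ ?_]
      rw [NNReal.smul_def, Real.coe_toNNReal _ (pow_nonneg (Set.mem_Ioi.1 hx).le _), smul_eq_mul]
    · exact (measurable_subtype_coe.pow_const _).real_toNNReal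
  have e1 : ∫ x, F x = ∫ p, H p ∂(sig.prod (Measure.volumeIoiPow 2)) := by
    calc ∫ x, F x = ∫ x : ({(0 : E3)}ᶜ : Set E3), F x ∂(Measure.comap Subtype.val volume) := by
          rw [integral_subtype_comap (measurableSet_singleton _).compl F,
            restrict_compl_singleton]
      _ = _ := by
          rw [sig, ← hmp.integral_comp (Homeomorph.measurableEmbedding _) H]
          exact integral_congr_ae (.of_forall fun x => (hH x).symm)
  constructor
  · have := hint.integral_prod_left
    simpa only [hin] using this
  · rw [e1, integral_prod _ hint]
    simp only [hin]

lemma sig_mp : MeasurePreserving (fun θ : S2 => -θ) sig sig := by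
    refine ⟨continuous_neg.measurable, ?_⟩
    ext s hs
    rw [Measure.map_apply continuous_neg.measurable hs, sig,
      Measure.toSphere_apply' _ hs, Measure.toSphere_apply' _ (continuous_neg.measurable hs)]
    congr 1
    rw [← Measure.measure_neg (volume : Measure E3) ]
    congr 1
    ext x
    simp only [Set.mem_neg, Set.mem_smul, Set.mem_image, Set.mem_preimage]
    constructor
    · rintro ⟨r, hr, _, ⟨y, hy, rfl⟩, hx⟩
      exact ⟨r, hr, _, ⟨-y, hy, rfl⟩, by simp [hx]⟩
    · rintro ⟨r, hr, _, ⟨y, hy, rfl⟩, hx⟩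
      exact ⟨r, hr, _, ⟨-y, by simpa using hy, rfl⟩, by simp [hx]⟩

lemma sig_neg (h : S2 → ℝ) : ∫ θ, h (-θ) ∂sig = ∫ θ, h θ ∂sig :=
  sig_mp.integral_comp (Homeomorph.neg S2).measurableEmbedding h

/-- radial profile -/
noncomputable def fr (R : E3 → ℝ) (θ : E3) (r : ℝ) : ℝ := r ^ 2 * R (r • θ)

lemma norm_rt {θ : E3} (hθ : ‖θ‖ = 1) {r : ℝ} (hr : 1 < r) : ‖r • θ‖ = r := by
  rw [norm_smul, hθ, mul_one, Real.norm_eq_abs, abs_of_pos (by linarith)]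

lemma fr_bound (R : E3 → ℝ) (c : ℝ)
    (hRbound : ∀ x : E3, 1 < ‖x‖ → |R x| ≤ c * ‖x‖⁻¹ ^ 4)
    (θ : E3) (hθ : ‖θ‖ = 1) (r : ℝ) (hr : 1 < r) : |fr R θ r| ≤ c * r⁻¹ ^ 2 := by
  have h := hRbound (r • θ) (by rw [norm_rt hθ hr]; exact hr)
  rw [norm_rt hθ hr] at h
  have hr0 : 0 < r := by linarith
  rw [fr, abs_mul, abs_of_nonneg (sq_nonneg r)]
  calc r ^ 2 * |R (r • θ)| ≤ r ^ 2 * (c * r⁻¹ ^ 4) := by gcongr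
    _ = _ := by field_simp

lemma open_ext : IsOpen {x : E3 | 1 < ‖x‖} := isOpen_lt continuous_const continuous_norm

lemma fr_hasDeriv (R : E3 → ℝ) (c : ℝ)
    (hR : ContDiffOn ℝ 1 R {x : E3 | 1 < ‖x‖})
    (hgrowth : ∀ x : E3, 1 < ‖x‖ →
      ∑ i : Fin 3,
        x i * fderiv ℝ (fun y : E3 => ‖y‖ ^ 2 * R y) x (EuclideanSpace.single i 1)
          ≤ c * ‖x‖⁻¹ ^ 3)
    (θ : E3) (hθ : ‖θ‖ = 1) (r : ℝ) (hr : 1 < r) :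
    ∃ f', HasDerivAt (fr R θ) f' r ∧ f' ≤ c * r⁻¹ ^ 4 := by
  have hn := norm_rt hθ hr
  have hx : 1 < ‖r • θ‖ := by rw [hn]; exact hr
  have hr0 : 0 < r := by linarith
  have hRd : DifferentiableAt ℝ R (r • θ) :=
    (hR.differentiableOn one_ne_zero).differentiableAt (open_ext.mem_nhds hx)
  have hu : DifferentiableAt ℝ (fun y : E3 => ‖y‖ ^ 2 * R y) (r • θ) :=
    (differentiableAt_id.norm_sq ℝ).mul hRd
  set L := fderiv ℝ (fun y : E3 => ‖y‖ ^ 2 * R y) (r • θ) with hL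
  have hcomp : HasDerivAt (fun s : ℝ => ‖s • θ‖ ^ 2 * R (s • θ)) (L θ) r := by
    have h1 : HasDerivAt (fun s : ℝ => s • θ) ((1:ℝ) • θ) r := (hasDerivAt_id r).smul_const θ
    rw [one_smul] at h1
    exact hu.hasFDerivAt.comp_hasDerivAt r h1
  have he : (fun s : ℝ => ‖s • θ‖ ^ 2 * R (s • θ)) = fr R θ := by
    funext s
    simp [fr, norm_smul, hθ]
  rw [he] at hcomp
  refine ⟨_, hcomp, ?_⟩
  have hg := hgrowth (r • θ) hx
  rw [hn, ← hL] at hg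
  have hs : ∑ i : Fin 3, (r • θ) i * L (EuclideanSpace.single i 1) = L (r • θ) := by
    conv_rhs => rw [← (EuclideanSpace.basisFun (Fin 3) ℝ).sum_repr (r • θ)]
    simp only [map_sum, map_smul (f := L), smul_eq_mul, EuclideanSpace.basisFun_repr,
      EuclideanSpace.basisFun_apply]
  rw [hs, map_smul, smul_eq_mul] at hg
  have : L θ = r⁻¹ * (r * L θ) := by field_simp
  rw [this]
  calc r⁻¹ * (r * L θ) ≤ r⁻¹ * (c * r⁻¹ ^ 3) := by gcongr
    _ = _ := by ring

lemma fr_mono (R : E3 → ℝ) (c : ℝ)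
    (hR : ContDiffOn ℝ 1 R {x : E3 | 1 < ‖x‖})
    (hgrowth : ∀ x : E3, 1 < ‖x‖ →
      ∑ i : Fin 3,
        x i * fderiv ℝ (fun y : E3 => ‖y‖ ^ 2 * R y) x (EuclideanSpace.single i 1)
          ≤ c * ‖x‖⁻¹ ^ 3)
    (θ : E3) (hθ : ‖θ‖ = 1) :
    AntitoneOn (fun r => fr R θ r + c / 3 * r⁻¹ ^ 3) (Set.Ioi 1) := by
  have key : ∀ r ∈ Set.Ioi (1:ℝ), ∃ g', HasDerivAt (fun r => fr R θ r + c / 3 * r⁻¹ ^ 3) g' r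
      ∧ g' ≤ 0 := by
    intro r hr
    have hr0 : (0:ℝ) < r := lt_trans one_pos hr
    obtain ⟨f', h1, h2⟩ := fr_hasDeriv R c hR hgrowth θ hθ r hr
    have h3 := h1.add (((hasDerivAt_inv hr0.ne').pow 3).const_mul (c / 3))
    refine ⟨_, h3, ?_⟩
    have : c / 3 * ((3:ℕ) * r⁻¹ ^ (3 - 1) * -(r ^ 2)⁻¹) = - (c * r⁻¹ ^ 4) := by
      rw [← inv_pow]; push_cast; ring
    rw [this]; linarith
  apply antitoneOn_of_deriv_nonpos (convex_Ioi 1)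
  · intro r hr
    obtain ⟨g', h, _⟩ := key r hr
    exact h.continuousAt.continuousWithinAt
  · rw [interior_Ioi]
    intro r hr
    obtain ⟨g', h, _⟩ := key r hr
    exact h.differentiableAt.differentiableWithinAt
  · rw [interior_Ioi]
    intro r hr
    obtain ⟨g', h, h'⟩ := key r hr
    rw [h.deriv]; exact h'

lemma fr_lower (R : E3 → ℝ) (c : ℝ)
    (hR : ContDiffOn ℝ 1 R {x : E3 | 1 < ‖x‖})
    (hRbound : ∀ x : E3, 1 < ‖x‖ → |R x| ≤ c * ‖x‖⁻¹ ^ 4)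
    (hgrowth : ∀ x : E3, 1 < ‖x‖ →
      ∑ i : Fin 3,
        x i * fderiv ℝ (fun y : E3 => ‖y‖ ^ 2 * R y) x (EuclideanSpace.single i 1)
          ≤ c * ‖x‖⁻¹ ^ 3)
    (θ : E3) (hθ : ‖θ‖ = 1) (r : ℝ) (hr : 1 < r) : -(c / 3 * r⁻¹ ^ 3) ≤ fr R θ r := by
  have hm := fr_mono R c hR hgrowth θ hθ
  have hinv : Filter.Tendsto (fun s : ℝ => s⁻¹) Filter.atTop (nhds 0) := tendsto_inv_atTop_zero
  have ht : Filter.Tendsto (fun s => -(c * s⁻¹ ^ 2) + c / 3 * s⁻¹ ^ 3) Filter.atTop (nhds 0) := by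
    have := (((hinv.pow 2).const_mul c).neg).add ((hinv.pow 3).const_mul (c / 3))
    simpa using this
  have : (0:ℝ) ≤ fr R θ r + c / 3 * r⁻¹ ^ 3 := by
    refine le_of_tendsto ht ?_
    filter_upwards [Filter.eventually_ge_atTop r] with s hs
    have h1 : (1:ℝ) < s := by linarith
    have := hm hr h1 hs
    have h2 := (abs_le.1 (fr_bound R c hRbound θ hθ s h1)).1
    simp only at this
    linarith
  linarith

lemma fr_cont (R : E3 → ℝ) (hR : ContDiffOn ℝ 1 R {x : E3 | 1 < ‖x‖})
    (θ : E3) (hθ : ‖θ‖ = 1) : ContinuousOn (fr R θ) (Set.Ioi 1) := by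
  unfold fr
  refine (continuousOn_pow 2).mul (hR.continuousOn.comp (by fun_prop) ?_)
  intro r hr
  simp only [Set.mem_ofPred_eq, norm_rt hθ hr]; exact hr

lemma fr_int (R : E3 → ℝ) (c : ℝ) (hR : ContDiffOn ℝ 1 R {x : E3 | 1 < ‖x‖})
    (hRbound : ∀ x : E3, 1 < ‖x‖ → |R x| ≤ c * ‖x‖⁻¹ ^ 4)
    (θ : E3) (hθ : ‖θ‖ = 1) : IntegrableOn (fr R θ) (Set.Ioi 1) := by
  have h1 : IntegrableOn (fun r : ℝ => c * r ^ (-2:ℝ)) (Set.Ioi 1) :=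
    (integrableOn_Ioi_rpow_of_lt (by norm_num) one_pos).const_mul c
  refine Integrable.mono' h1 ((fr_cont R hR θ hθ).aestronglyMeasurable measurableSet_Ioi) ?_
  filter_upwards [ae_restrict_mem measurableSet_Ioi] with r hr
  have hr0 : (0:ℝ) < r := lt_trans one_pos hr
  have := fr_bound R c hRbound θ hθ r hr
  rw [Real.norm_eq_abs]
  refine this.trans (le_of_eq ?_)
  rw [Real.rpow_neg hr0.le, inv_pow]
  norm_num

noncomputable def Ph (R : E3 → ℝ) (θ : E3) (s : ℝ) : ℝ := ∫ r in Set.Ioi s, fr R θ r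

lemma Ph_deriv (R : E3 → ℝ) (c : ℝ) (hR : ContDiffOn ℝ 1 R {x : E3 | 1 < ‖x‖})
    (hRbound : ∀ x : E3, 1 < ‖x‖ → |R x| ≤ c * ‖x‖⁻¹ ^ 4)
    (θ : E3) (hθ : ‖θ‖ = 1) (s : ℝ) (hs : 1 < s) :
    HasDerivAt (Ph R θ) (-fr R θ s) s := by
  have hI := fr_int R c hR hRbound θ hθ
  have hc := fr_cont R hR θ hθ
  have h1 : HasDerivAt (fun t => ∫ r in (2:ℝ)..t, fr R θ r) (fr R θ s) s := by
    apply intervalIntegral.integral_hasDerivAt_right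
    · refine (hI.mono_set ?_).intervalIntegrable
      intro x hx
      have := hx.1
      simp only [Set.mem_Ioi]
      have h3 : (1:ℝ) < min 2 s := lt_min (by norm_num) hs
      linarith
    · exact hc.stronglyMeasurableAtFilter isOpen_Ioi s hs
    · exact hc.continuousAt (Ioi_mem_nhds hs)
  have h2 := h1.const_sub (∫ r in Set.Ioi (2:ℝ), fr R θ r)
  refine h2.congr_of_eventuallyEq ?_
  filter_upwards [Ioi_mem_nhds hs] with t ht
  have ht' : (1:ℝ) < t := ht
  have := intervalIntegral.integral_Ioi_sub_Ioi' (hI.mono_set (Set.Ioi_subset_Ioi (by norm_num : (1:ℝ) ≤ 2)))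
    (hI.mono_set (Set.Ioi_subset_Ioi ht'.le))
  rw [← this, Ph]; ring

noncomputable def tau (θ ξ : E3) : ℝ := inner ℝ θ ξ
noncomputable def Dd (θ ξ : E3) : ℝ := Real.sqrt (1 - ‖ξ‖ ^ 2 + tau θ ξ ^ 2)
noncomputable def rho (lam : ℝ) (θ ξ : E3) : ℝ := lam * (tau θ ξ + Dd θ ξ)

lemma tau_abs {θ ξ : E3} (hθ : ‖θ‖ = 1) : |tau θ ξ| ≤ ‖ξ‖ := by
  have := abs_real_inner_le_norm θ ξ
  rwa [hθ, one_mul] at this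

lemma Dd_ge {δ : ℝ} (hδ₀ : 0 < δ) (hδ₁ : δ < 1 / 2) {θ ξ : E3}
    (hξ : ‖ξ‖ < 1 - δ) : δ ≤ Dd θ ξ := by
  apply Real.le_sqrt_of_sq_le
  nlinarith [norm_nonneg ξ, sq_nonneg (tau θ ξ)]

lemma Dd_sq {δ : ℝ} (hδ₀ : 0 < δ) {θ ξ : E3}
    (hξ : ‖ξ‖ < 1 - δ) : Dd θ ξ ^ 2 = 1 - ‖ξ‖ ^ 2 + tau θ ξ ^ 2 := by
  apply Real.sq_sqrt
  nlinarith [norm_nonneg ξ, sq_nonneg (tau θ ξ)]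

lemma tau_add_Dd_ge {δ : ℝ} (hδ₀ : 0 < δ) {θ ξ : E3} (hθ : ‖θ‖ = 1)
    (hξ : ‖ξ‖ < 1 - δ) : δ ≤ tau θ ξ + Dd θ ξ := by
  have h1 := (abs_le.1 (tau_abs (ξ := ξ) hθ)).1
  have : δ - tau θ ξ ≤ Dd θ ξ := by
    apply Real.le_sqrt_of_sq_le
    nlinarith [norm_nonneg ξ]
  linarith

lemma tau_neg (θ ξ : E3) : tau (-θ) ξ = - tau θ ξ := inner_neg_left _ _
lemma Dd_neg (θ ξ : E3) : Dd (-θ) ξ = Dd θ ξ := by simp [Dd, tau_neg]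

lemma rho_iff {δ lam : ℝ} (hδ₀ : 0 < δ) (hl : 0 < lam) {θ ξ : E3} (hθ : ‖θ‖ = 1)
    (hξ : ‖ξ‖ < 1 - δ) {r : ℝ} (hr : 0 < r) :
    lam ≤ ‖r • θ - lam • ξ‖ ↔ rho lam θ ξ ≤ r := by
  have hsq : ‖r • θ - lam • ξ‖ ^ 2 = r ^ 2 - 2 * (r * lam * tau θ ξ) + lam ^ 2 * ‖ξ‖ ^ 2 := by
    rw [@norm_sub_sq_real, norm_smul, norm_smul, hθ, inner_smul_left, inner_smul_right]
    simp only [tau, mul_pow, Real.norm_eq_abs, sq_abs, one_pow, mul_one]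
    simp
    ring
  have hD := Dd_sq hδ₀ (θ := θ) hξ
  have hD0 : 0 ≤ Dd θ ξ := Real.sqrt_nonneg _
  have h2 := tau_add_Dd_ge hδ₀ (θ := -θ) (by simpa using hθ) hξ
  rw [tau_neg, Dd_neg] at h2
  have hfac : ‖r • θ - lam • ξ‖ ^ 2 - lam ^ 2 =
      (r - lam * (tau θ ξ + Dd θ ξ)) * (r + lam * (Dd θ ξ - tau θ ξ)) := by
    rw [hsq]; linear_combination (lam ^ 2) * hD
  have hpos : 0 < r + lam * (Dd θ ξ - tau θ ξ) := by
    have : 0 < lam * (Dd θ ξ - tau θ ξ) := mul_pos hl (by linarith)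
    linarith
  rw [← sq_le_sq₀ hl.le (norm_nonneg _), ← sub_nonneg, hfac, mul_nonneg_iff_of_pos_right hpos,
    sub_nonneg, rho]

noncomputable def rhoD (lam : ℝ) (θ ξ : E3) : E3 →L[ℝ] ℝ :=
  lam • (innerSL ℝ θ + (Dd θ ξ)⁻¹ • (tau θ ξ • innerSL ℝ θ - innerSL ℝ ξ))

lemma rho_deriv {δ lam : ℝ} (hδ₀ : 0 < δ) {θ ξ : E3}
    (hδ₁ : δ < 1 / 2) (hξ : ‖ξ‖ < 1 - δ) :
    HasFDerivAt (rho lam θ) (rhoD lam θ ξ) ξ := by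
  have hDpos : 0 < Dd θ ξ := hδ₀.trans_le (Dd_ge hδ₀ hδ₁ hξ)
  have hτ : HasFDerivAt (tau θ) (innerSL ℝ θ) ξ := (innerSL ℝ θ).hasFDerivAt
  have hn : HasFDerivAt (fun x : E3 => ‖x‖ ^ 2) (2 • (innerSL ℝ ξ)) ξ :=
    (hasStrictFDerivAt_norm_sq ξ).hasFDerivAt
  have h1 := (hn.const_sub 1).add (hτ.pow 2)
  have h2 := h1.sqrt (by
    have := Dd_sq hδ₀ (θ := θ) hξ
    have h3 : 0 < Dd θ ξ ^ 2 := by positivity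
    rw [this] at h3
    exact h3.ne')
  have h3 := (hτ.add h2).const_mul lam
  refine h3.congr_fderiv ?_
  ext w
  have : √(1 - ‖ξ‖ ^ 2 + tau θ ξ ^ 2) = Dd θ ξ := rfl
  simp [rhoD, this]
  field_simp
  ring

lemma rhoD_bound {δ lam : ℝ} (hδ₀ : 0 < δ) (hδ₁ : δ < 1 / 2) (hl : 0 < lam) {θ ξ : E3}
    (hθ : ‖θ‖ = 1) (hξ : ‖ξ‖ < 1 - δ) : ‖rhoD lam θ ξ‖ ≤ lam * (1 + δ⁻¹ * 2) := by
  have hD := Dd_ge hδ₀ hδ₁ (θ := θ) hξ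
  have hτ := tau_abs (ξ := ξ) hθ
  have hx : ‖ξ‖ ≤ 1 := by linarith
  have hDp : 0 < Dd θ ξ := by linarith
  rw [rhoD, norm_smul, Real.norm_eq_abs, abs_of_pos hl]
  gcongr
  refine (norm_add_le _ _).trans ?_
  rw [innerSL_apply_norm, hθ, norm_smul, norm_inv, Real.norm_eq_abs, abs_of_pos hDp]
  have : ‖tau θ ξ • innerSL ℝ θ - innerSL ℝ ξ‖ ≤ 2 := by
    refine (norm_sub_le _ _).trans ?_
    rw [norm_smul, innerSL_apply_norm, innerSL_apply_norm, hθ, Real.norm_eq_abs]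
    linarith
  gcongr

lemma rhoD_apply (lam : ℝ) (θ ξ : E3) :
    rhoD lam θ ξ ξ = lam * (tau θ ξ + (Dd θ ξ)⁻¹ * (tau θ ξ ^ 2 - ‖ξ‖ ^ 2)) := by
  simp [rhoD, tau]
  ring

lemma R_int (R : E3 → ℝ) (c : ℝ) (hc : 0 < c) (hR : ContDiffOn ℝ 1 R {x : E3 | 1 < ‖x‖})
    (hRbound : ∀ x : E3, 1 < ‖x‖ → |R x| ≤ c * ‖x‖⁻¹ ^ 4) :
    IntegrableOn R {x : E3 | 1 < ‖x‖} := by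
  have h1 : Integrable (fun x : E3 => (c * 16) * (1 + ‖x‖) ^ (-4:ℝ)) :=
    (integrable_one_add_norm (by simp; norm_num)).const_mul _
  refine Integrable.mono' h1.integrableOn
    (hR.continuousOn.aestronglyMeasurable open_ext.measurableSet) ?_
  filter_upwards [ae_restrict_mem open_ext.measurableSet] with x hx
  have hx' : 1 < ‖x‖ := hx
  rw [Real.norm_eq_abs]
  refine (hRbound x hx).trans ?_
  rw [Real.rpow_neg (by positivity)]
  have : (1 + ‖x‖) ^ (4:ℝ) = (1 + ‖x‖) ^ 4 := by norm_cast
  rw [this, mul_assoc]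
  gcongr
  have h3 : (1 + ‖x‖) ^ 4 ≤ (2 * ‖x‖) ^ 4 := by gcongr; linarith
  rw [inv_pow, ← div_eq_mul_inv, inv_le_comm₀ (by positivity) (by positivity), inv_div,
    div_le_iff₀ (by norm_num)]
  linarith [h3, (by ring : (2 * ‖x‖) ^ 4 = ‖x‖ ^ 4 * 16)]

lemma G2_polar (R : E3 → ℝ) (c : ℝ) (hc : 0 < c) (hR : ContDiffOn ℝ 1 R {x : E3 | 1 < ‖x‖})
    (hRbound : ∀ x : E3, 1 < ‖x‖ → |R x| ≤ c * ‖x‖⁻¹ ^ 4) {δ lam : ℝ} (hδ₀ : 0 < δ)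
    (hl : 1 < lam * δ) (ξ : E3) (hξ : ‖ξ‖ < 1 - δ) :
    Integrable (fun θ : S2 => Ph R θ (rho lam θ ξ)) sig ∧
    ∫ x in {x : E3 | lam ≤ ‖x - lam • ξ‖}, R x = ∫ θ : S2, Ph R θ (rho lam θ ξ) ∂sig := by
  have hl0 : 0 < lam := by
    by_contra h
    nlinarith
  set A := {x : E3 | lam ≤ ‖x - lam • ξ‖} with hA
  have hAm : MeasurableSet A := by
    apply IsClosed.measurableSet
    exact isClosed_le continuous_const (by fun_prop)
  have hsub : A ⊆ {x : E3 | 1 < ‖x‖} := by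
    intro x hx
    have hx' : lam ≤ ‖x - lam • ξ‖ := hx
    have h1 := norm_sub_le x (lam • ξ)
    rw [norm_smul, Real.norm_eq_abs, abs_of_pos hl0] at h1
    show 1 < ‖x‖
    nlinarith
  have hF : Integrable (A.indicator R) :=
    (integrable_indicator_iff hAm).2 ((R_int R c hc hR hRbound).mono_set hsub)
  have hin : ∀ θ : S2, ∫ r in Set.Ioi (0:ℝ), r ^ 2 * A.indicator R (r • (θ : E3)) =
      Ph R θ (rho lam θ ξ) := by
    intro θ
    have hθ : ‖(θ : E3)‖ = 1 := by simp
    have hrho : 0 < rho lam θ ξ := mul_pos hl0 (hδ₀.trans_le (tau_add_Dd_ge hδ₀ hθ hξ))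
    have : ∫ r in Set.Ioi (0:ℝ), r ^ 2 * A.indicator R (r • (θ : E3)) =
        ∫ r in Set.Ioi (0:ℝ), (Set.Ici (rho lam θ ξ)).indicator (fr R θ) r := by
      refine setIntegral_congr_fun measurableSet_Ioi ?_
      intro r hr
      have hi := rho_iff hδ₀ hl0 hθ hξ (Set.mem_Ioi.1 hr)
      by_cases h : rho lam θ ξ ≤ r
      · have h' : r • (θ : E3) ∈ A := hi.2 h
        simp [Set.indicator, h, h', fr]
      · have h' : r • (θ : E3) ∉ A := fun h'' => h (hi.1 h'')
        simp only [Set.indicator, h, h', Set.mem_Ici, if_false, mul_zero]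
    rw [this, setIntegral_indicator measurableSet_Ici, Ph, ← integral_Ici_eq_integral_Ioi]
    congr 2
    ext r
    simp only [Set.mem_inter_iff, Set.mem_Ioi, Set.mem_Ici]
    constructor
    · exact fun h => h.2
    · exact fun h => ⟨by linarith, h⟩
  obtain ⟨h1, h2⟩ := polar _ hF
  simp only [hin] at h1 h2
  refine ⟨h1, ?_⟩
  rw [← h2, integral_indicator hAm]

lemma rho_cont (lam : ℝ) (ξ : E3) : Continuous (fun θ : S2 => rho lam θ ξ) := by
  unfold rho Dd tau
  fun_prop

lemma G2_deriv (R : E3 → ℝ) (c : ℝ) (hc : 0 < c) (hR : ContDiffOn ℝ 1 R {x : E3 | 1 < ‖x‖})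
    (hRbound : ∀ x : E3, 1 < ‖x‖ → |R x| ≤ c * ‖x‖⁻¹ ^ 4) {δ lam : ℝ} (hδ₀ : 0 < δ)
    (hδ₁ : δ < 1 / 2)
    (hl : 1 < lam * δ) (ξ : E3) (hξ : ‖ξ‖ < 1 - δ) :
    Integrable (fun θ : S2 => (-fr R θ (rho lam θ ξ)) • rhoD lam θ ξ) sig ∧
    HasFDerivAt (G2 R lam) ((2 * lam) •
      ∫ θ : S2, (-fr R θ (rho lam θ ξ)) • rhoD lam θ ξ ∂sig) ξ := by
  have hl0 : 0 < lam := by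
    by_contra h
    nlinarith
  have hs : ball (0 : E3) (1 - δ) ∈ nhds ξ := isOpen_ball.mem_nhds (by simpa using hξ)
  have hr1 : ∀ (θ : S2) (x : E3), ‖x‖ < 1 - δ → 1 < rho lam θ x := by
    intro θ x hx
    have := tau_add_Dd_ge hδ₀ (θ := (θ : E3)) (by simp) hx
    unfold rho
    nlinarith
  have hmeas : AEStronglyMeasurable
      (fun θ : S2 => (-fr R θ (rho lam θ ξ)) • rhoD lam θ ξ) sig := by
    apply Continuous.aestronglyMeasurable
    have h1 : Continuous (fun θ : S2 => fr R θ (rho lam θ ξ)) := by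
      unfold fr
      refine ((rho_cont lam ξ).pow 2).mul ?_
      refine hR.continuousOn.comp_continuous
        ((rho_cont lam ξ).smul continuous_subtype_val) ?_
      intro θ
      rw [Set.mem_ofPred_eq, norm_rt (by simp) (hr1 θ ξ hξ)]
      exact hr1 θ ξ hξ
    refine h1.neg.smul ?_
    have hD : ∀ θ : S2, Dd θ ξ ≠ 0 := fun θ => (hδ₀.trans_le (Dd_ge hδ₀ hδ₁ hξ)).ne'
    have hDc : Continuous (fun θ : S2 => Dd θ ξ) := by unfold Dd tau; fun_prop
    have htc : Continuous (fun θ : S2 => tau θ ξ) := by unfold tau; fun_prop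
    have hic : Continuous (fun θ : S2 => innerSL ℝ (θ : E3)) :=
      (innerSL ℝ (E := E3)).continuous.comp continuous_subtype_val
    unfold rhoD
    exact (hic.add ((hDc.inv₀ hD).smul ((htc.smul hic).sub continuous_const))).const_smul lam
  have hbd : ∀ (θ : S2) (x : E3), x ∈ ball (0 : E3) (1 - δ) →
      ‖(-fr R θ (rho lam θ x)) • rhoD lam θ x‖ ≤ c * (lam * (1 + δ⁻¹ * 2)) := by
    intro θ x hx
    have hx' : ‖x‖ < 1 - δ := by simpa using hx
    rw [norm_smul, norm_neg, Real.norm_eq_abs]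
    have h1 := fr_bound R c hRbound θ (by simp) _ (hr1 θ x hx')
    have h2 : (rho lam θ x)⁻¹ ≤ 1 := inv_le_one_of_one_le₀ (hr1 θ x hx').le
    have h3 : 0 ≤ (rho lam θ x)⁻¹ := inv_nonneg.2 (by linarith [hr1 θ x hx'])
    have h4 : |fr R θ (rho lam θ x)| ≤ c := by
      refine h1.trans ?_
      have : (rho lam θ x)⁻¹ ^ 2 ≤ 1 := pow_le_one₀ h3 h2
      nlinarith
    exact mul_le_mul h4 (rhoD_bound hδ₀ hδ₁ hl0 (by simp) hx') (norm_nonneg _) hc.le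
  refine ⟨Integrable.of_bound hmeas _ (.of_forall fun θ => hbd θ ξ (by simpa using hξ)), ?_⟩
  have key := hasFDerivAt_integral_of_dominated_of_fderiv_le (𝕜 := ℝ) (μ := sig)
    (F := fun x (θ : S2) => Ph R θ (rho lam θ x))
    (F' := fun x (θ : S2) => (-fr R θ (rho lam θ x)) • rhoD lam θ x)
    (bound := fun _ => c * (lam * (1 + δ⁻¹ * 2))) hs ?_ ?_ hmeas (.of_forall hbd)
    (integrable_const _) ?_
  · have h := key.const_smul (2 * lam)
    refine h.congr_of_eventuallyEq ?_
    filter_upwards [hs] with x hx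
    have hx' : ‖x‖ < 1 - δ := by simpa using hx
    simp only [G2, Pi.smul_apply, smul_eq_mul]
    rw [(G2_polar R c hc hR hRbound hδ₀ hl x hx').2]
  · filter_upwards [hs] with x hx
    have hx' : ‖x‖ < 1 - δ := by simpa using hx
    exact (G2_polar R c hc hR hRbound hδ₀ hl x hx').1.aestronglyMeasurable
  · exact (G2_polar R c hc hR hRbound hδ₀ hl ξ hξ).1
  · refine .of_forall fun θ x hx => ?_
    have hx' : ‖x‖ < 1 - δ := by simpa using hx
    exact (Ph_deriv R c hR hRbound θ (by simp) _ (hr1 θ x hx')).comp_hasFDerivAt x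
      (rho_deriv hδ₀ hδ₁ hx')

/-- the integrand -/
noncomputable def hh (R : E3 → ℝ) (lam : ℝ) (ξ θ : E3) : ℝ :=
  fr R θ (rho lam θ ξ) * rhoD lam θ ξ ξ

lemma hh_pair (R : E3 → ℝ) (c : ℝ) (hc : 0 < c) (hR : ContDiffOn ℝ 1 R {x : E3 | 1 < ‖x‖})
    (hRbound : ∀ x : E3, 1 < ‖x‖ → |R x| ≤ c * ‖x‖⁻¹ ^ 4)
    (hgrowth : ∀ x : E3, 1 < ‖x‖ →
      ∑ i : Fin 3,
        x i * fderiv ℝ (fun y : E3 => ‖y‖ ^ 2 * R y) x (EuclideanSpace.single i 1)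
          ≤ c * ‖x‖⁻¹ ^ 3)
    (hodd : ∀ x : E3, 1 < ‖x‖ → |R x - R (-x)| ≤ c * ‖x‖⁻¹ ^ 5)
    {δ lam : ℝ} (hδ₀ : 0 < δ) (hδ₁ : δ < 1 / 2)
    (hl : 1 < lam * δ) (ξ : E3) (hξ : ‖ξ‖ < 1 - δ) (θ : E3) (hθ : ‖θ‖ = 1) (hτ : 0 ≤ tau θ ξ) :
    hh R lam ξ θ + hh R lam ξ (-θ) ≤
      lam * ‖ξ‖ * ((2 * c + 2 * c * δ⁻¹) * (lam * δ)⁻¹ ^ 3) := by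
  have hl0 : 0 < lam := by
    by_contra h
    nlinarith
  have hD := Dd_ge hδ₀ hδ₁ (θ := θ) hξ
  have hDp : 0 < Dd θ ξ := by linarith
  have hθ' : ‖-θ‖ = 1 := by simpa using hθ
  have hm := tau_add_Dd_ge hδ₀ hθ' hξ
  have hta := (abs_le.1 (tau_abs (ξ := ξ) hθ)).2
  set τ := tau θ ξ with hτd
  set D := Dd θ ξ with hDd
  have hrp : rho lam θ ξ = lam * (τ + D) := rfl
  have hrm : rho lam (-θ) ξ = lam * (-τ + D) := by rw [rho, tau_neg, Dd_neg]
  rw [tau_neg, Dd_neg] at hm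
  set p := lam * (τ + D) with hp
  set m := lam * (-τ + D) with hmd
  have hm1 : lam * δ ≤ m := mul_le_mul_of_nonneg_left hm hl0.le
  have hpm : m ≤ p := mul_le_mul_of_nonneg_left (by linarith) hl0.le
  have h1m : 1 < m := by linarith
  have h1p : 1 < p := by linarith
  set ε := (lam * δ)⁻¹ ^ 3 with hε
  have hε0 : 0 < ε := by positivity
  have hmε : m⁻¹ ^ 3 ≤ ε := by rw [hε]; gcongr
  have hpε : p⁻¹ ^ 3 ≤ ε := by rw [hε]; gcongr; linarith
  have hcm : c * m⁻¹ ^ 3 ≤ c * ε := by gcongr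
  have hcp : c * p⁻¹ ^ 3 ≤ c * ε := by gcongr
  have hp0 : 0 ≤ c * p⁻¹ ^ 3 := by positivity
  have hcε : 0 < c * ε := by positivity
  have l1 := fr_lower R c hR hRbound hgrowth θ hθ p h1p
  have l2 := fr_lower R c hR hRbound hgrowth (-θ) hθ' m h1m
  have mono := fr_mono R c hR hgrowth θ hθ h1m h1p hpm
  simp only at mono
  have odd : fr R θ m - fr R (-θ) m ≤ c * m⁻¹ ^ 3 := by
    have h := hodd (m • θ) (by rw [norm_rt hθ h1m]; exact h1m)
    rw [norm_rt hθ h1m] at h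
    have h' := (abs_le.1 h).2
    unfold fr
    rw [smul_neg, ← mul_sub]
    calc m ^ 2 * (R (m • θ) - R (-(m • θ))) ≤ m ^ 2 * (c * m⁻¹ ^ 5) := by gcongr
      _ = _ := by field_simp
  have hd : fr R θ p - fr R (-θ) m ≤ 2 * c * ε := by linarith
  have hsum : -(2 * c * ε) ≤ fr R θ p + fr R (-θ) m := by linarith
  set q := D⁻¹ * (‖ξ‖ ^ 2 - τ ^ 2) with hq
  have hq1 : 0 ≤ ‖ξ‖ ^ 2 - τ ^ 2 := by nlinarith
  have hq0 : 0 ≤ q := by positivity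
  have hqle : q ≤ δ⁻¹ * ‖ξ‖ := by
    rw [hq]
    have h1 : D⁻¹ ≤ δ⁻¹ := by gcongr
    have h2 : ‖ξ‖ ^ 2 - τ ^ 2 ≤ ‖ξ‖ := by nlinarith [norm_nonneg ξ, sq_nonneg τ]
    exact mul_le_mul h1 h2 hq1 (by positivity)
  have heq : hh R lam ξ θ + hh R lam ξ (-θ) =
      lam * (τ * (fr R θ p - fr R (-θ) m) - q * (fr R θ p + fr R (-θ) m)) := by
    unfold hh
    rw [hrp, hrm, rhoD_apply, rhoD_apply, tau_neg, Dd_neg, ← hτd, ← hDd, hq]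
    ring
  rw [heq, mul_assoc lam]
  refine mul_le_mul_of_nonneg_left ?_ hl0.le
  have a1 : τ * (fr R θ p - fr R (-θ) m) ≤ ‖ξ‖ * (2 * c * ε) :=
    (mul_le_mul_of_nonneg_left hd hτ).trans (mul_le_mul_of_nonneg_right hta (by positivity))
  have a2 : q * (-(fr R θ p + fr R (-θ) m)) ≤ (δ⁻¹ * ‖ξ‖) * (2 * c * ε) :=
    (mul_le_mul_of_nonneg_left (by linarith) hq0).trans
      (mul_le_mul_of_nonneg_right hqle (by positivity))
  linarith

theorem stmt3 (δ : ℝ) (hδ₀ : 0 < δ) (hδ₁ : δ < 1 / 2) (R : E3 → ℝ) (c : ℝ) (hc : 0 < c)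
    (hR : ContDiffOn ℝ 1 R {x : E3 | 1 < ‖x‖})
    (hRbound : ∀ x : E3, 1 < ‖x‖ → |R x| ≤ c * ‖x‖⁻¹ ^ 4)
    (hDRbound : ∀ x : E3, 1 < ‖x‖ → ‖fderiv ℝ R x‖ ≤ c * ‖x‖⁻¹ ^ 5)
    (hgrowth : ∀ x : E3, 1 < ‖x‖ →
      ∑ i : Fin 3,
        x i * fderiv ℝ (fun y : E3 => ‖y‖ ^ 2 * R y) x (EuclideanSpace.single i 1)
          ≤ c * ‖x‖⁻¹ ^ 3)
    (hodd : ∀ x : E3, 1 < ‖x‖ → |R x - R (-x)| ≤ c * ‖x‖⁻¹ ^ 5) :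
    ∃ C > (0 : ℝ), ∃ lam₀ > (0 : ℝ), ∀ lam : ℝ, lam₀ ≤ lam → ∀ ξ : E3,
      0 < ‖ξ‖ → ‖ξ‖ < 1 - δ →
      DifferentiableAt ℝ (G2 R lam) ξ ∧
        ‖ξ‖⁻¹ * fderiv ℝ (G2 R lam) ξ ξ ≥ -(C * lam⁻¹) := by
  have hK : 0 < (2 * c + 2 * c * δ⁻¹) * δ⁻¹ ^ 3 := by positivity
  have hσ : 0 ≤ sig.real Set.univ := measureReal_nonneg
  refine ⟨(2 * c + 2 * c * δ⁻¹) * δ⁻¹ ^ 3 * sig.real Set.univ + 1, by positivity,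
    2 / δ, by positivity, ?_⟩
  intro lam hlam ξ hξ0 hξ
  have hl : 1 < lam * δ := by
    rw [div_le_iff₀ hδ₀] at hlam
    linarith
  have hl0 : 0 < lam := lt_of_lt_of_le (by positivity) hlam
  obtain ⟨hI, hD⟩ := G2_deriv R c hc hR hRbound hδ₀ hδ₁ hl ξ hξ
  refine ⟨hD.differentiableAt, ?_⟩
  set M := lam * ‖ξ‖ * ((2 * c + 2 * c * δ⁻¹) * (lam * δ)⁻¹ ^ 3) with hM
  have hhI : Integrable (fun θ : S2 => hh R lam ξ θ) sig := by
    have h1 := (hI.apply_continuousLinearMap ξ).neg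
    refine h1.congr (.of_forall fun θ => ?_)
    simp [hh]
  have hval : (∫ θ : S2, (-fr R θ (rho lam θ ξ)) • rhoD lam θ ξ ∂sig) ξ =
      -∫ θ : S2, hh R lam ξ θ ∂sig := by
    rw [ContinuousLinearMap.integral_apply hI, ← integral_neg]
    refine integral_congr_ae (.of_forall fun θ => ?_)
    simp [hh]
  have hneg : ∫ θ : S2, hh R lam ξ (-θ : E3) ∂sig = ∫ θ : S2, hh R lam ξ θ ∂sig :=
    sig_neg (fun θ : S2 => hh R lam ξ θ)
  have hpair : ∀ θ : S2, hh R lam ξ θ + hh R lam ξ (-θ : E3) ≤ M := by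
    intro θ
    rcases le_total 0 (tau θ ξ) with h | h
    · exact hh_pair R c hc hR hRbound hgrowth hodd hδ₀ hδ₁ hl ξ hξ θ (by simp) h
    · have := hh_pair R c hc hR hRbound hgrowth hodd hδ₀ hδ₁ hl ξ hξ (-θ) (by simp)
        (by rw [tau_neg]; linarith)
      rw [neg_neg] at this
      linarith
  have hnegI : Integrable (fun θ : S2 => hh R lam ξ (-θ : E3)) sig := by
    have := sig_mp.integrable_comp_of_integrable hhI
    exact this
  have hle : 2 * ∫ θ : S2, hh R lam ξ θ ∂sig ≤ sig.real Set.univ * M := by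
    calc 2 * ∫ θ : S2, hh R lam ξ θ ∂sig
        = ∫ θ : S2, (hh R lam ξ θ + hh R lam ξ (-θ : E3)) ∂sig := by
          rw [integral_add hhI hnegI, hneg]; ring
      _ ≤ ∫ θ : S2, M ∂sig := integral_mono (hhI.add hnegI) (integrable_const _) hpair
      _ = _ := by rw [integral_const, smul_eq_mul]
  rw [hD.fderiv, smul_apply, hval, smul_eq_mul]
  have e : ‖ξ‖⁻¹ * (2 * lam * -∫ θ : S2, hh R lam ξ θ ∂sig) =
      -(‖ξ‖⁻¹ * lam * (2 * ∫ θ : S2, hh R lam ξ θ ∂sig)) := by ring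
  rw [e, ge_iff_le, neg_le_neg_iff]
  calc ‖ξ‖⁻¹ * lam * (2 * ∫ θ : S2, hh R lam ξ θ ∂sig)
      ≤ ‖ξ‖⁻¹ * lam * (sig.real Set.univ * M) := by gcongr
    _ = (2 * c + 2 * c * δ⁻¹) * δ⁻¹ ^ 3 * sig.real Set.univ * lam⁻¹ := by
        rw [hM]; field_simp
    _ ≤ _ := by
        have : 0 < lam⁻¹ := by positivity
        nlinarith
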